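/- Let X and Y be two independent positive random variables with strictly positive densities on (0,∞) whose logarithms are locally integrable. Define U = Y/(1+X) and V = X(1 + Y/(1+X)). If U and V are independent, then there exist constants a, b, c > 0 such that X has the Kummer distribution K(a, b−a, c) and Y has the Gamma distribution G(b, c); equivalently, U has the Kummer distribution K(b, a−b, c) and V has the Gamma distribution G(a, c). -/

import Mathlib

open MeasureTheory ProbabilityTheory Filter Topology Set

/-- `μ` is the Kummer distribution `K(a,b,c)`: it has a density on `(0,∞)` proportional to
`x^(a-1) (1+x)^(-(a+b)) exp (-c x)` with respect to Lebesgue measure. -/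
def IsKummer (μ : Measure ℝ) (a b c : ℝ) : Prop :=
  ∃ C : ℝ, 0 < C ∧
    μ = volume.withDensity fun x =>
      ENNReal.ofReal ((Ioi (0 : ℝ)).indicator
        (fun x => C * x ^ (a - 1) * (1 + x) ^ (-(a + b)) * Real.exp (-(c * x))) x)

/-- `μ` is the Gamma distribution `G(b,c)`: it has a density on `(0,∞)` proportional to
`y^(b-1) exp (-c y)` with respect to Lebesgue measure. -/
def IsGamma (μ : Measure ℝ) (b c : ℝ) : Prop :=
  ∃ C : ℝ, 0 < C ∧
    μ = volume.withDensity fun x =>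
      ENNReal.ofReal ((Ioi (0 : ℝ)).indicator
        (fun x => C * x ^ (b - 1) * Real.exp (-(c * x))) x)

/-- On `(0,∞)`, local integrability means interval integrability between positive endpoints. -/
lemma locallyIntegrableOn_Ioi_zero_iff {h : ℝ → ℝ} :
    LocallyIntegrableOn h (Ioi 0) ↔
      ∀ m M : ℝ, 0 < m → 0 < M → IntervalIntegrable h volume m M := by
  rw [locallyIntegrableOn_iff isOpen_Ioi.isLocallyClosed]
  constructor
  · intro H m M hm hM
    rw [intervalIntegrable_iff']
    exact H _ (fun x hx => lt_of_lt_of_le (lt_min hm hM) hx.1) isCompact_uIcc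
  · intro H k hk hkc
    rcases k.eq_empty_or_nonempty with rfl | hne
    · simp
    obtain ⟨m, hm, hmin⟩ := hkc.exists_isLeast hne
    obtain ⟨M, hM, hmax⟩ := hkc.exists_isGreatest hne
    have := H m M (hk hm) (hk hM)
    rw [intervalIntegrable_iff_integrableOn_Icc_of_le (hmin hM)] at this
    exact this.mono_set fun x hx => ⟨hmin hx, hmax hx⟩

lemma MeasureTheory.LocallyIntegrableOn.comp_affine {h : ℝ → ℝ} (hh : LocallyIntegrableOn h (Ioi 0))
    {p q : ℝ} (hp : 0 < p) (hq : 0 ≤ q) :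
    LocallyIntegrableOn (fun x => h (p * x + q)) (Ioi 0) := by
  rw [locallyIntegrableOn_Ioi_zero_iff] at hh ⊢
  intro m M hm hM
  have h1 := (hh (p * m + q) (p * M + q) (by positivity) (by positivity)).comp_add_right q
  simpa [hp.ne'] using h1.comp_mul_left (c := p)

lemma MeasureTheory.LocallyIntegrableOn.of_comp_mul {h : ℝ → ℝ} {p : ℝ} (hp : 0 < p)
    (hh : LocallyIntegrableOn (fun x => h (p * x)) (Ioi 0)) :
    LocallyIntegrableOn h (Ioi 0) := by
  have := LocallyIntegrableOn.comp_affine hh (inv_pos.2 hp) le_rfl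
  simpa [← mul_assoc, hp.ne'] using this

lemma MeasureTheory.LocallyIntegrableOn.congr_ae_Ioi {f g : ℝ → ℝ} (hf : LocallyIntegrableOn f (Ioi 0))
    (h : ∀ᵐ x, 0 < x → f x = g x) : LocallyIntegrableOn g (Ioi 0) := by
  rw [locallyIntegrableOn_Ioi_zero_iff] at hf ⊢
  intro m M hm hM
  refine (hf m M hm hM).congr_ae ?_
  rw [EventuallyEq, ae_restrict_iff' measurableSet_uIoc]
  filter_upwards [h] with x hx hxm
  exact hx ((lt_min hm hM).trans hxm.1)

/-- An integral of a locally integrable function against a kernel whose slices have a common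
compact support is as smooth as the kernel. -/
lemma contDiffOn_integral_kernel {h : ℝ → ℝ} (hh : LocallyIntegrableOn h (Ioi 0))
    {K : ℝ → ℝ → ℝ} {s : Set ℝ} (hs : IsOpen s) {m M : ℝ} (hm : 0 < m)
    (hK : ∀ y ∈ s, ∀ v, v ∉ Icc m M → K y v = 0)
    (hc : ContDiffOn ℝ 2 (fun z : ℝ × ℝ => K z.1 z.2) (s ×ˢ univ)) :
    (∀ y ∈ s, Integrable fun v => K y v * h v) ∧
      ContDiffOn ℝ 2 (fun y => ∫ v, K y v * h v) s := by
  have hInt : IntegrableOn h (Icc m M) :=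
    hh.integrableOn_compact_subset (fun x hx => hm.trans_le hx.1) isCompact_Icc
  constructor
  · intro y hy
    have hcont : Continuous (K y) := by
      have : ContinuousOn (fun v => K y v) univ :=
        hc.continuousOn.comp (f := fun v : ℝ => (y, v)) (by fun_prop) (fun v _ => ⟨hy, trivial⟩)
      exact continuousOn_univ.1 this
    have : IntegrableOn (fun v => K y v * h v) (Icc m M) :=
      hInt.continuousOn_mul hcont.continuousOn isCompact_Icc
    refine (integrableOn_iff_integrable_of_support_subset ?_).1 this
    intro v hv
    by_contra hn
    exact hv (by simp [hK y hy v hn])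
  · set f : ℝ → ℝ := (Icc m M).indicator h with hf
    have hfint : LocallyIntegrable f :=
      ((integrable_indicator_iff measurableSet_Icc).2 hInt).locallyIntegrable
    have key := contDiffOn_convolution_right_with_param (μ := volume) (n := 2)
      (ContinuousLinearMap.mul ℝ ℝ) (g := fun y t => K y (-t)) (k := Icc (-M) (-m)) hs
      isCompact_Icc
      (fun p x hp hx => hK p hp _ fun hx' => hx ⟨by linarith [hx'.2], by linarith [hx'.1]⟩)
      hfint (hc.comp (f := fun z : ℝ × ℝ => (z.1, -z.2)) (by fun_prop)
        (fun z hz => ⟨hz.1, trivial⟩))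
    have k2 := key.comp (f := fun y : ℝ => (y, (0 : ℝ))) (s := s) (by fun_prop)
      (fun y hy => ⟨hy, trivial⟩)
    refine k2.congr fun y hy => ?_
    simp only [Function.comp, convolution, ContinuousLinearMap.mul_apply', zero_sub, neg_neg]
    refine integral_congr_ae (ae_of_all _ fun v => ?_)
    by_cases hv : v ∈ Icc m M
    · simp [hf, hv, mul_comm]
    · simp [hK y hy v hv]

/-- Change of variables `x = R v` for an integral against a weight supported in the range. -/
lemma integral_weight_comp {w h R d R' G : ℝ → ℝ} {s : Set ℝ} (hs : MeasurableSet s)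
    (hR : ∀ v ∈ s, HasDerivAt R (d v) v) (hR' : ∀ v ∈ s, |d v| = R' v)
    (hG : ∀ v ∈ s, G (R v) = v) (hw : ∀ x, w x ≠ 0 → x ∈ R '' s)
    (hK : ∀ v, w (R v) * R' v ≠ 0 → v ∈ s)
    (hInt : Integrable fun v => w (R v) * R' v * h v) :
    Integrable (fun x => w x * h (G x)) ∧
      ∫ x, w x * h (G x) = ∫ v, w (R v) * R' v * h v := by
  have hinj : InjOn R s := fun a ha b hb hab => by rw [← hG a ha, ← hG b hb, hab]
  have hR2 : ∀ v ∈ s, HasDerivWithinAt R (d v) s v := fun v hv => (hR v hv).hasDerivWithinAt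
  have hsub : (Function.support fun x => w x * h (G x)) ⊆ R '' s := fun x hx =>
    hw x (left_ne_zero_of_mul hx)
  have hsub' : (Function.support fun v => w (R v) * R' v * h v) ⊆ s := fun x hx =>
    hK x (left_ne_zero_of_mul hx)
  have heq : EqOn (fun v => |d v| • (w (R v) * h (G (R v)))) (fun v => w (R v) * R' v * h v) s := by
    intro v hv
    simp only [hR' v hv, hG v hv, smul_eq_mul]
    ring
  constructor
  · rw [← integrableOn_iff_integrable_of_support_subset hsub,
      integrableOn_image_iff_integrableOn_abs_deriv_smul hs hR2 hinj,
      integrableOn_congr_fun heq hs]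
    exact hInt.integrableOn
  · rw [← setIntegral_eq_integral_of_forall_compl_eq_zero (s := R '' s),
      integral_image_eq_integral_abs_deriv_smul hs hR2 hinj, setIntegral_congr_fun hs heq,
      setIntegral_eq_integral_of_forall_compl_eq_zero]
    · intro x hx; by_contra hn; exact hx (hsub' hn)
    · intro x hx; by_contra hn; exact hx (hsub hn)

lemma contDiffOn_integral_comp_div {w h : ℝ → ℝ} (hw : ContDiff ℝ 2 w)
    (hsupp : ∀ x, w x ≠ 0 → x ∈ Ioo (1 : ℝ) 3) (hh : LocallyIntegrableOn h (Ioi 0)) :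
    (∀ y, 0 < y → Integrable fun x => w x * h (y / (1 + x))) ∧
      ContDiffOn ℝ 2 (fun y => ∫ x, w x * h (y / (1 + x))) (Ioi 0) := by
  set K : ℝ → ℝ → ℝ := fun y u => w (y / u - 1) * (y / u ^ 2) with hKdef
  have hKsupp : ∀ y u, 0 < y → K y u ≠ 0 → 0 < u ∧ 2 * u < y ∧ y < 4 * u := by
    intro y u hy hne
    have h1 := hsupp _ (left_ne_zero_of_mul hne)
    have h2 : 0 < y / u := by linarith [h1.1]
    have hu : 0 < u := by
      by_contra hn
      exact absurd h2 (not_lt.2 (div_nonpos_of_nonneg_of_nonpos hy.le (not_lt.1 hn)))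
    have h3 : 2 < y / u := by linarith [h1.1]
    have h4 : y / u < 4 := by linarith [h1.2]
    rw [lt_div_iff₀ hu] at h3
    rw [div_lt_iff₀ hu] at h4
    exact ⟨hu, h3, h4⟩
  have hloc : ∀ y₀, 0 < y₀ →
      (∀ y ∈ Ioo (y₀ / 2) (2 * y₀), Integrable fun v => K y v * h v) ∧
      ContDiffOn ℝ 2 (fun y => ∫ v, K y v * h v) (Ioo (y₀ / 2) (2 * y₀)) := by
    intro y₀ hy₀
    refine contDiffOn_integral_kernel hh isOpen_Ioo (m := y₀ / 8) (M := y₀) (by positivity) ?_ ?_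
    · intro y hy u hu
      by_contra hne
      obtain ⟨_, h2, h3⟩ := hKsupp y u (by linarith [hy.1]) hne
      exact hu ⟨by linarith [hy.1], by linarith [hy.2]⟩
    · rintro ⟨y, u⟩ ⟨hy, -⟩
      refine ContDiffAt.contDiffWithinAt ?_
      rcases eq_or_ne u 0 with rfl | hu
      · have : (fun z : ℝ × ℝ => K z.1 z.2) =ᶠ[𝓝 (y, 0)] fun _ => 0 := by
          have ho : IsOpen (Ioo (y₀ / 2) (2 * y₀) ×ˢ Iio (y₀ / 8)) := isOpen_Ioo.prod isOpen_Iio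
          filter_upwards [ho.mem_nhds ⟨hy, by simp [hy₀]⟩] with z hz
          by_contra hne
          obtain ⟨_, h2, h3⟩ := hKsupp z.1 z.2 (by linarith [hz.1.1]) hne
          have := hz.2
          simp only [mem_Iio] at this
          linarith [hz.1.1]
        exact contDiffAt_const.congr_of_eventuallyEq this
      · have hd : ContDiffAt ℝ 2 (fun z : ℝ × ℝ => z.1 / z.2) (y, u) :=
          contDiffAt_fst.div contDiffAt_snd hu
        have hd2 : ContDiffAt ℝ 2 (fun z : ℝ × ℝ => z.1 / z.2 ^ 2) (y, u) :=
          contDiffAt_fst.div (contDiffAt_snd.pow 2) (pow_ne_zero 2 hu)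
        exact (hw.contDiffAt.comp (y, u) (hd.sub contDiffAt_const)).mul hd2
  have hmem : ∀ y : ℝ, 0 < y → y ∈ Ioo (y / 2) (2 * y) := fun y hy =>
    ⟨by linarith, by linarith⟩
  have hcv : ∀ y, 0 < y → Integrable (fun x => w x * h (y / (1 + x))) ∧
      ∫ x, w x * h (y / (1 + x)) = ∫ v, K y v * h v := by
    intro y hy
    refine integral_weight_comp (R := fun u => y / u - 1) (R' := fun u => y / u ^ 2)
      (G := fun x => y / (1 + x))
      (d := fun u => -(y / u ^ 2)) (s := Ioi 0) measurableSet_Ioi ?_ ?_ ?_ ?_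
      (fun u hu => (hKsupp y u hy hu).1) ((hloc y hy).1 y (hmem y hy))
    · intro u hu
      simpa [div_eq_mul_inv] using ((hasDerivAt_inv (ne_of_gt hu)).const_mul y).sub_const 1
    · intro u _
      rw [abs_neg, abs_of_nonneg (by positivity)]
    · intro u hu
      rw [add_sub_cancel, div_div_cancel₀ hy.ne']
    · intro x hx
      have hx1 : 0 < 1 + x := by linarith [(hsupp x hx).1]
      refine ⟨y / (1 + x), div_pos hy hx1, ?_⟩
      field_simp
      ring
  refine ⟨fun y hy => (hcv y hy).1, fun y hy => ContDiffAt.contDiffWithinAt ?_⟩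
  refine (((hloc y hy).2 y (hmem y hy)).contDiffAt (Ioo_mem_nhds (hmem y hy).1 (hmem y hy).2)).congr_of_eventuallyEq ?_
  filter_upwards [Ioi_mem_nhds hy] with z hz using (hcv z hz).2

lemma contDiffOn_integral_comp_mul {w h : ℝ → ℝ} (hw : ContDiff ℝ 2 w)
    (hsupp : ∀ x, w x ≠ 0 → x ∈ Ioo (1 : ℝ) 3) (hh : LocallyIntegrableOn h (Ioi 0)) :
    (∀ y, 0 < y → Integrable fun x => w x * h (x * (1 + y / (1 + x)))) ∧
      ContDiffOn ℝ 2 (fun y => ∫ x, w x * h (x * (1 + y / (1 + x)))) (Ioi 0) := by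
  set D : ℝ → ℝ → ℝ := fun y v => √((v + 1 - y) ^ 2 + 4 * y) with hD
  set R : ℝ → ℝ → ℝ := fun y v => ((v + 1 - y) + D y v) / 2 - 1 with hRdef
  set R' : ℝ → ℝ → ℝ := fun y v => (1 + (v + 1 - y) / D y v) / 2 with hR'def
  set K : ℝ → ℝ → ℝ := fun y v => w (R y v) * R' y v with hKdef
  have hDpos : ∀ y v, 0 < y → 0 < D y v := fun y v hy => Real.sqrt_pos.2 (by positivity)
  have hDsq : ∀ y v, 0 < y → D y v ^ 2 = (v + 1 - y) ^ 2 + 4 * y := fun y v hy =>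
    Real.sq_sqrt (by positivity)
  have habs : ∀ y v, 0 < y → |v + 1 - y| < D y v := fun y v hy =>
    abs_lt_of_sq_lt_sq (by linarith [hDsq y v hy]) (hDpos y v hy).le
  have hR1 : ∀ y v, 0 < y → 0 < 1 + R y v := by
    intro y v hy
    have := (abs_lt.1 (habs y v hy)).1
    simp only [hRdef]; linarith
  have hG : ∀ y v, 0 < y → R y v * (1 + y / (1 + R y v)) = v := by
    intro y v hy
    have h1 := hR1 y v hy
    have h2 := hDsq y v hy
    field_simp
    simp only [hRdef]
    nlinarith
  have hKsupp : ∀ y v, 0 < y → K y v ≠ 0 → 1 < v ∧ v < 3 + y := by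
    intro y v hy hne
    have h1 := hsupp _ (left_ne_zero_of_mul hne)
    have h2 := hG y v hy
    have h3 : 0 < y / (1 + R y v) := div_pos hy (hR1 y v hy)
    have h4 : R y v * (y / (1 + R y v)) < y := by
      rw [mul_div_assoc', div_lt_iff₀ (hR1 y v hy)]
      nlinarith
    constructor <;> nlinarith [h1.1, h1.2]
  have hloc : ∀ y₀, 0 < y₀ →
      (∀ y ∈ Ioo (y₀ / 2) (2 * y₀), Integrable fun v => K y v * h v) ∧
      ContDiffOn ℝ 2 (fun y => ∫ v, K y v * h v) (Ioo (y₀ / 2) (2 * y₀)) := by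
    intro y₀ hy₀
    refine contDiffOn_integral_kernel hh isOpen_Ioo (m := 1) (M := 3 + 2 * y₀) (by positivity) ?_ ?_
    · intro y hy u hu
      by_contra hne
      obtain ⟨h2, h3⟩ := hKsupp y u (by linarith [hy.1]) hne
      exact hu ⟨by linarith [hy.1], by linarith [hy.2]⟩
    · rintro ⟨y, v⟩ ⟨hy, -⟩
      refine ContDiffAt.contDiffWithinAt ?_
      have hy' : 0 < y := by linarith [hy.1]
      have hDc : ContDiffAt ℝ 2 (fun z : ℝ × ℝ => D z.1 z.2) (y, v) :=
        ContDiffAt.sqrt (by fun_prop) (by simp only; positivity)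
      have hlin : ContDiffAt ℝ 2 (fun z : ℝ × ℝ => z.2 + 1 - z.1) (y, v) := by fun_prop
      have hRc : ContDiffAt ℝ 2 (fun z : ℝ × ℝ => R z.1 z.2) (y, v) :=
        ((hlin.add hDc).div_const 2).sub contDiffAt_const
      have hR'c : ContDiffAt ℝ 2 (fun z : ℝ × ℝ => R' z.1 z.2) (y, v) :=
        (contDiffAt_const.add (hlin.div hDc (hDpos y v hy').ne')).div_const 2
      exact (hw.contDiffAt.comp (y, v) hRc).mul hR'c
  have hmem : ∀ y : ℝ, 0 < y → y ∈ Ioo (y / 2) (2 * y) := fun y hy =>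
    ⟨by linarith, by linarith⟩
  have hcv : ∀ y, 0 < y → Integrable (fun x => w x * h (x * (1 + y / (1 + x)))) ∧
      ∫ x, w x * h (x * (1 + y / (1 + x))) = ∫ v, K y v * h v := by
    intro y hy
    refine integral_weight_comp (R := R y) (d := R' y) (R' := R' y) (G := fun x => x * (1 + y / (1 + x)))
      (s := univ) MeasurableSet.univ ?_ ?_ (fun v _ => hG y v hy) ?_ (fun _ _ => trivial)
      ((hloc y hy).1 y (hmem y hy))
    · intro v _
      have hlin : HasDerivAt (fun v : ℝ => v + 1 - y) 1 v := by
        simpa using ((hasDerivAt_id v).add_const 1).sub_const y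
      have hs := ((hlin.pow 2).add_const (4 * y)).sqrt (by simp only [Pi.pow_apply]; positivity)
      have := ((hlin.add hs).div_const 2).sub_const 1
      refine this.congr_deriv ?_
      have hne : √((v + 1 - y) ^ 2 + 4 * y) ≠ 0 := (hDpos y v hy).ne'
      simp only [hR'def, hD, Pi.pow_apply]
      field_simp
      push_cast
      ring
    · intro v _
      have h1 := (abs_lt.1 (habs y v hy)).1
      have h2 : -1 < (v + 1 - y) / D y v := by
        rw [lt_div_iff₀ (hDpos y v hy)]; linarith
      rw [abs_of_nonneg]
      simp only [hR'def]; linarith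
    · intro x hx
      have h1 := (hsupp x hx).1
      refine ⟨x * (1 + y / (1 + x)), trivial, ?_⟩
      have hx1 : 0 < 1 + x := by linarith
      have : D y (x * (1 + y / (1 + x))) = (1 + x) + y / (1 + x) := by
        simp only [hD]
        rw [Real.sqrt_eq_iff_mul_self_eq (by positivity) (by positivity)]
        field_simp
        ring
      simp only [hRdef, this]
      field_simp
      ring
  refine ⟨fun y hy => (hcv y hy).1, fun y hy => ContDiffAt.contDiffWithinAt ?_⟩
  refine (((hloc y hy).2 y (hmem y hy)).contDiffAt
    (Ioo_mem_nhds (hmem y hy).1 (hmem y hy).2)).congr_of_eventuallyEq ?_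
  filter_upwards [Ioi_mem_nhds hy] with z hz using (hcv z hz).2

lemma ae_comp_mul_right {p : ℝ → Prop} (hp : ∀ᵐ y, p y) {c : ℝ} (hc : c ≠ 0) :
    ∀ᵐ y, p (y * c) := by
  rw [ae_iff] at hp ⊢
  have := Real.volume_preimage_mul_right hc {y | ¬ p y}
  rw [hp, mul_zero] at this
  exact this

lemma ae_swap {p : ℝ × ℝ → Prop} (hp : ∀ᵐ z, p z) : ∀ᵐ z, p (Prod.swap z) :=
  (Measure.measurePreserving_swap (μ := (volume : Measure ℝ))
    (ν := (volume : Measure ℝ))).quasiMeasurePreserving.ae hp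

lemma ae_prod_of_forall_ae {p : ℝ × ℝ → Prop} {q : ℝ → Prop} {f : ℝ × ℝ → ℝ}
    (hq : ∀ᵐ y, q y) (hf : Measurable f)
    (hsec : ∀ N : Set ℝ, volume N = 0 → ∀ x, 0 < x → volume {u | f (x, u) ∈ N} = 0)
    (hpq : ∀ z : ℝ × ℝ, 0 < z.1 → q (f z) → p z) :
    ∀ᵐ z : ℝ × ℝ, 0 < z.1 → p z := by
  set N := toMeasurable volume {y | ¬ q y} with hN
  have hN0 : volume N = 0 := by rw [hN, measure_toMeasurable]; exact hq
  have hNm : MeasurableSet N := measurableSet_toMeasurable _ _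
  have hB : MeasurableSet {z : ℝ × ℝ | 0 < z.1 ∧ f z ∈ N} :=
    (measurableSet_lt measurable_const measurable_fst).inter (hf hNm)
  have hB0 : (volume : Measure (ℝ × ℝ)) {z : ℝ × ℝ | 0 < z.1 ∧ f z ∈ N} = 0 := by
    rw [Measure.volume_eq_prod, Measure.measure_prod_null hB]
    refine ae_of_all _ fun x => ?_
    by_cases hx : 0 < x
    · exact measure_mono_null (fun u hu => hu.2) (hsec N hN0 x hx)
    · simp [hx]
  filter_upwards [measure_eq_zero_iff_ae_notMem.1 hB0] with z hz hz1
  refine hpq z hz1 ?_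
  by_contra hn
  exact hz ⟨hz1, subset_toMeasurable _ _ hn⟩

lemma ae_prod_comp_mul {p : ℝ → Prop} (hp : ∀ᵐ y, p y) :
    ∀ᵐ z : ℝ × ℝ, 0 < z.1 → p (z.2 * (1 + z.1)) := by
  refine ae_prod_of_forall_ae (f := fun z => z.2 * (1 + z.1)) hp (by fun_prop) ?_
    fun z _ h => h
  intro N hN x hx
  have := ae_comp_mul_right (measure_eq_zero_iff_ae_notMem.1 hN) (c := 1 + x) (by positivity)
  simpa [ae_iff] using this

lemma exists_contDiffOn_ae_eq {α β γ δ : ℝ → ℝ} (hα : LocallyIntegrableOn α (Ioi 0))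
    (hγ : LocallyIntegrableOn γ (Ioi 0)) (hδ : LocallyIntegrableOn δ (Ioi 0))
    (hE : ∀ᵐ z : ℝ × ℝ, 0 < z.1 → 0 < z.2 →
      α z.1 + β (z.2 * (1 + z.1)) = γ z.2 + δ (z.1 * (1 + z.2))) :
    ∃ F : ℝ → ℝ, ContDiffOn ℝ 2 F (Ioi 0) ∧ ∀ᵐ y, 0 < y → β y = F y := by
  have hyx : ∀ᵐ y : ℝ, ∀ᵐ x : ℝ, 0 < x → 0 < y →
      α x + β y = γ (y / (1 + x)) + δ (x * (1 + y / (1 + x))) := by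
    set N := toMeasurable volume {z : ℝ × ℝ | ¬ (0 < z.1 → 0 < z.2 →
      α z.1 + β (z.2 * (1 + z.1)) = γ z.2 + δ (z.1 * (1 + z.2)))} with hN
    have hN0 : (volume : Measure (ℝ × ℝ)) N = 0 := by rw [hN, measure_toMeasurable]; exact hE
    have hNm : MeasurableSet N := measurableSet_toMeasurable _ _
    have h1 : ∀ᵐ x : ℝ, ∀ᵐ u : ℝ, (x, u) ∉ N :=
      Measure.ae_ae_of_ae_prod (measure_eq_zero_iff_ae_notMem.1 hN0)
    have h2 : ∀ᵐ x : ℝ, ∀ᵐ y : ℝ, 0 < x → (x, y / (1 + x)) ∉ N := by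
      filter_upwards [h1] with x hx
      by_cases hx0 : 0 < x
      · filter_upwards [ae_comp_mul_right hx (c := (1 + x)⁻¹) (by positivity)] with y hy _
        exact hy
      · simp [hx0]
    have hm : MeasurableSet {z : ℝ × ℝ | 0 < z.1 → (z.1, z.2 / (1 + z.1)) ∉ N} := by
      have hf : Measurable fun z : ℝ × ℝ => (z.1, z.2 / (1 + z.1)) := by fun_prop
      have : {z : ℝ × ℝ | 0 < z.1 → (z.1, z.2 / (1 + z.1)) ∉ N} =
          {z : ℝ × ℝ | 0 < z.1}ᶜ ∪ ((fun z : ℝ × ℝ => (z.1, z.2 / (1 + z.1))) ⁻¹' N)ᶜ := by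
        ext z; simp only [mem_ofPred_eq, mem_union, mem_compl_iff, mem_preimage]; tauto
      rw [this]
      exact (measurableSet_lt measurable_const measurable_fst).compl.union (hf hNm).compl
    rw [Measure.ae_ae_comm hm] at h2
    filter_upwards [h2] with y hy
    filter_upwards [hy] with x hx hx0 hy0
    have hnot := fun hh => hx hx0 (subset_toMeasurable _ _ hh)
    have h3 := not_not.1 hnot hx0 (div_pos hy0 (by positivity))
    have h4 : y / (1 + x) * (1 + x) = y := div_mul_cancel₀ _ (by positivity)
    simpa only [h4] using h3
  let f : ContDiffBump (2 : ℝ) := ⟨1 / 2, 1, by norm_num, by norm_num⟩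
  set w : ℝ → ℝ := f.normed volume with hw
  have hwc : ContDiff ℝ 2 w := f.contDiff_normed
  have hw1 : ∫ x, w x = 1 := f.integral_normed
  have hsupp : ∀ x, w x ≠ 0 → x ∈ Ioo (1 : ℝ) 3 := by
    intro x hx
    have : x ∈ Function.support w := hx
    rw [hw, f.support_normed_eq, Real.ball_eq_Ioo] at this
    simp only [f] at this
    norm_num at this
    exact this
  obtain ⟨hγi, hγc⟩ := contDiffOn_integral_comp_div hwc hsupp hγ
  obtain ⟨hδi, hδc⟩ := contDiffOn_integral_comp_mul hwc hsupp hδ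
  have hαi : Integrable fun x => w x * α x :=
    (contDiffOn_integral_kernel hα (K := fun _ x => w x) isOpen_univ one_pos (M := 3)
      (fun _ _ v hv => by
        by_contra hn
        exact hv (Ioo_subset_Icc_self (hsupp v hn)))
      (hwc.comp contDiff_snd).contDiffOn).1 0 trivial
  refine ⟨_, (hγc.add hδc).sub (contDiffOn_const (c := ∫ x, w x * α x)), ?_⟩
  filter_upwards [hyx] with y hy hy0
  have h1 : β y = ∫ x, w x * β y := by rw [integral_mul_const, hw1, one_mul]
  have hadd : Integrable fun x => w x * γ (y / (1 + x)) + w x * δ (x * (1 + y / (1 + x))) :=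
    (hγi y hy0).add (hδi y hy0)
  rw [h1, ← integral_add (hγi y hy0) (hδi y hy0), ← integral_sub hadd hαi]
  refine integral_congr_ae ?_
  filter_upwards [hy] with x hx
  by_cases hwx : w x = 0
  · simp [hwx]
  · have := hx (by linarith [(hsupp x hwx).1]) hy0
    linear_combination w x * this

/-- The `C²` solutions of the functional equation, by a mixed second derivative. -/
lemma exists_const_deriv_mul_deriv {A β Γ δ : ℝ → ℝ} (hβ : ContDiffOn ℝ 2 β (Ioi 0))
    (hδ : ContDiffOn ℝ 2 δ (Ioi 0))
    (hE : ∀ x u, 0 < x → 0 < u → A x + β (u * (1 + x)) = Γ u + δ (x * (1 + u))) :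
    ∃ c : ℝ, (∀ y, 0 < y → HasDerivAt (fun y => y * deriv β y) (-c) y) ∧
      ∀ v, 0 < v → HasDerivAt (fun v => v * deriv δ v) (-c) v := by
  have hd1 : ∀ {f : ℝ → ℝ}, ContDiffOn ℝ 2 f (Ioi 0) → ∀ y, 0 < y → HasDerivAt f (deriv f y) y :=
    fun hf y hy => ((hf.differentiableOn (by norm_num)).differentiableAt
      (Ioi_mem_nhds hy)).hasDerivAt
  have hd2 : ∀ {f : ℝ → ℝ}, ContDiffOn ℝ 2 f (Ioi 0) → ∀ y, 0 < y →
      HasDerivAt (fun y => y * deriv f y) (deriv (fun y => y * deriv f y) y) y := by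
    intro f hf y hy
    have h1 : ContDiffOn ℝ 1 (deriv f) (Ioi 0) := hf.deriv_of_isOpen isOpen_Ioi (by norm_num)
    exact (differentiableAt_id.mul ((h1.differentiableOn (by norm_num)).differentiableAt
      (Ioi_mem_nhds hy))).hasDerivAt
  have hstep : ∀ x u, 0 < x → 0 < u →
      (1 + x) * deriv β (u * (1 + x)) - x * deriv δ (x * (1 + u)) = deriv Γ u := by
    intro x u hx hu
    have e1 : HasDerivAt (fun u => β (u * (1 + x))) (deriv β (u * (1 + x)) * (1 * (1 + x))) u :=
      (hd1 hβ (u * (1 + x)) (by positivity)).comp u ((hasDerivAt_id u).mul_const (1 + x))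
    have e2 : HasDerivAt (fun u => δ (x * (1 + u))) (deriv δ (x * (1 + u)) * (x * 1)) u :=
      (hd1 hδ (x * (1 + u)) (by positivity)).comp u (((hasDerivAt_id u).const_add 1).const_mul x)
    have e3 := ((e1.sub e2).const_add (A x))
    have e4 : HasDerivAt Γ _ u := e3.congr_of_eventuallyEq (by
      filter_upwards [Ioi_mem_nhds hu] with t ht
      simp only [Pi.sub_apply]
      linarith [hE x t hx ht])
    rw [e4.deriv]; ring
  have hmix : ∀ x u, 0 < x → 0 < u → deriv (fun y => y * deriv β y) (u * (1 + x)) =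
      deriv (fun y => y * deriv δ y) (x * (1 + u)) := by
    intro x u hx hu
    have e1 : HasDerivAt (fun x => (u * (1 + x)) * deriv β (u * (1 + x)))
        (deriv (fun y => y * deriv β y) (u * (1 + x)) * (u * 1)) x :=
      HasDerivAt.comp (h₂ := fun y => y * deriv β y) x (hd2 hβ (u * (1 + x)) (by positivity)) (((hasDerivAt_id x).const_add 1).const_mul u)
    have e2 : HasDerivAt (fun x => (x * (1 + u)) * deriv δ (x * (1 + u)))
        (deriv (fun y => y * deriv δ y) (x * (1 + u)) * (1 * (1 + u))) x :=
      HasDerivAt.comp (h₂ := fun y => y * deriv δ y) x (hd2 hδ (x * (1 + u)) (by positivity)) ((hasDerivAt_id x).mul_const (1 + u))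
    have e3 := e1.sub (e2.const_mul (u / (1 + u)))
    have e4 := e3.unique ((hasDerivAt_const x (u * deriv Γ u)).congr_of_eventuallyEq (by
      filter_upwards [Ioi_mem_nhds hx] with t ht
      simp only [Pi.sub_apply]
      rw [← hstep t u ht hu]
      field_simp))
    have h5 : u / (1 + u) * (1 + u) = u := div_mul_cancel₀ _ (by positivity)
    have h6 : u * (deriv (fun y => y * deriv β y) (u * (1 + x)) -
      deriv (fun y => y * deriv δ y) (x * (1 + u))) = 0 := by
      linear_combination e4 + deriv (fun y => y * deriv δ y) (x * (1 + u)) * h5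
    linarith [(mul_eq_zero.1 h6).resolve_left hu.ne']
  have hex : ∀ v y : ℝ, 0 < v → 0 < y → ∃ x u : ℝ, 0 < x ∧ 0 < u ∧ u * (1 + x) = y ∧
      x * (1 + u) = v := by
    intro v y hv hy
    set D := √((v + 1 - y) ^ 2 + 4 * y) with hD
    have hD0 : 0 < D := Real.sqrt_pos.2 (by positivity)
    have hDs : D ^ 2 = (v + 1 - y) ^ 2 + 4 * y := Real.sq_sqrt (by positivity)
    refine ⟨(v + 1 - y + D) / 2 - 1, (D - (v + 1 - y)) / 2, ?_, ?_, ?_, ?_⟩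
    · nlinarith
    · nlinarith
    · nlinarith
    · nlinarith
  refine ⟨-deriv (fun y => y * deriv β y) 1, fun y hy => ?_, fun v hv => ?_⟩
  · obtain ⟨x, u, hx, hu, h1, h2⟩ := hex 1 y one_pos hy
    obtain ⟨x', u', hx', hu', h1', h2'⟩ := hex 1 1 one_pos one_pos
    have e := hmix x u hx hu
    have e' := hmix x' u' hx' hu'
    rw [h1, h2] at e
    rw [h1', h2'] at e'
    rw [neg_neg, e', ← e]
    exact hd2 hβ y hy
  · obtain ⟨x, u, hx, hu, h1, h2⟩ := hex v 1 hv one_pos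
    have e := hmix x u hx hu
    rw [h1, h2] at e
    rw [neg_neg, e]
    exact hd2 hδ v hv

lemma eq_log_of_hasDerivAt_mul_deriv {f : ℝ → ℝ} {c : ℝ}
    (hf : ∀ y, 0 < y → HasDerivAt f (deriv f y) y)
    (h : ∀ y, 0 < y → HasDerivAt (fun y => y * deriv f y) (-c) y) :
    ∃ k l : ℝ, ∀ y, 0 < y → f y = k * Real.log y - c * y + l := by
  have hconst : ∀ g : ℝ → ℝ, (∀ y, 0 < y → HasDerivAt g 0 y) → ∀ y, 0 < y → g y = g 1 := by
    intro g hg y hy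
    exact isOpen_Ioi.is_const_of_deriv_eq_zero (convex_Ioi (0 : ℝ)).isPreconnected
      (fun z hz => (hg z hz).differentiableAt.differentiableWithinAt)
      (fun z hz => (hg z hz).deriv) hy (mem_Ioi.2 one_pos)
  have h1 := hconst (fun y => y * deriv f y + c * y) fun y hy => by
    exact ((h y hy).add ((hasDerivAt_id y).const_mul c)).congr_deriv (by ring)
  set k := 1 * deriv f 1 + c * 1 with hk
  have h2 := hconst (fun y => f y - k * Real.log y + c * y) fun y hy => by
    have := ((hf y hy).sub ((Real.hasDerivAt_log hy.ne').const_mul k)).add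
      ((hasDerivAt_id y).const_mul c)
    refine this.congr_deriv ?_
    have := h1 y hy
    field_simp
    linear_combination this
  refine ⟨k, f 1 - k * Real.log 1 + c * 1, fun y hy => ?_⟩
  have := h2 y hy
  linear_combination this

lemma exists_pos_of_ae {p : ℝ → Prop} (h : ∀ᵐ x, p x) : ∃ x, 0 < x ∧ p x := by
  by_contra! hn
  have : volume (Ioi (0 : ℝ)) = 0 := measure_mono_null (fun x hx => hn x hx) (ae_iff.1 h)
  simp at this

/-- The locally integrable solutions of the functional equation satisfied by the logarithms
of the densities. -/
lemma kummer_gamma_functional_equation {α β γ δ : ℝ → ℝ}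
    (hα : LocallyIntegrableOn α (Ioi 0)) (hβ : LocallyIntegrableOn β (Ioi 0))
    (hE : ∀ᵐ z : ℝ × ℝ, 0 < z.1 → 0 < z.2 →
      α z.1 + β (z.2 * (1 + z.1)) = γ z.2 + δ (z.1 * (1 + z.2))) :
    ∃ a b c k₁ k₂ k₃ k₄ : ℝ,
      (∀ᵐ x, 0 < x → α x = a * Real.log x - b * Real.log (1 + x) - c * x + k₁) ∧
      (∀ᵐ y, 0 < y → β y = b * Real.log y - c * y + k₂) ∧
      (∀ᵐ u, 0 < u → γ u = b * Real.log u - a * Real.log (1 + u) - c * u + k₃) ∧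
      ∀ᵐ v, 0 < v → δ v = a * Real.log v - c * v + k₄ := by
  have hδ : LocallyIntegrableOn δ (Ioi 0) := by
    obtain ⟨u, hu, hs⟩ := exists_pos_of_ae (Measure.ae_ae_of_ae_prod (ae_swap hE))
    refine LocallyIntegrableOn.of_comp_mul (p := 1 + u) (by positivity) ?_
    refine LocallyIntegrableOn.congr_ae_Ioi ((hα.add (hβ.comp_affine hu hu.le)).sub
      (locallyIntegrableOn_const (γ u))) ?_
    filter_upwards [hs] with x hx hx0
    have := hx hx0 hu
    simp only [Prod.fst_swap, Prod.snd_swap] at this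
    rw [mul_comm (1 + u), Pi.sub_apply, Pi.add_apply, ← mul_add_one, add_comm x]
    linarith
  have hγ : LocallyIntegrableOn γ (Ioi 0) := by
    obtain ⟨x, hx, hs⟩ := exists_pos_of_ae (Measure.ae_ae_of_ae_prod hE)
    refine LocallyIntegrableOn.congr_ae_Ioi (((locallyIntegrableOn_const (α x)).add
      (hβ.comp_affine (p := 1 + x) (by positivity) le_rfl)).sub (hδ.comp_affine hx hx.le)) ?_
    filter_upwards [hs] with u hu hu0
    have := hu hx hu0
    rw [Pi.sub_apply, Pi.add_apply, ← mul_add_one, add_comm u, add_zero, mul_comm (1 + x)]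
    linarith
  obtain ⟨F, hFc, hF⟩ := exists_contDiffOn_ae_eq hα hγ hδ hE
  obtain ⟨G, hGc, hG⟩ := exists_contDiffOn_ae_eq hγ hα hβ (β := δ) (by
    filter_upwards [ae_swap hE] with z hz h1 h2
    exact (hz h2 h1).symm)
  have hE' : ∀ᵐ z : ℝ × ℝ, 0 < z.1 → 0 < z.2 →
      α z.1 + F (z.2 * (1 + z.1)) = γ z.2 + G (z.1 * (1 + z.2)) := by
    filter_upwards [hE, ae_prod_comp_mul hF, ae_swap (ae_prod_comp_mul hG)] with z h0 h1 h2 hx hu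
    simp only [Prod.fst_swap, Prod.snd_swap] at h2
    rw [← h1 hx (by positivity), ← h2 hu (by positivity)]
    exact h0 hx hu
  obtain ⟨x₀, hx₀, hΓ⟩ := exists_pos_of_ae (Measure.ae_ae_of_ae_prod hE')
  obtain ⟨u₀, hu₀, hA⟩ := exists_pos_of_ae (Measure.ae_ae_of_ae_prod (ae_swap hE'))
  simp only [Prod.fst_swap, Prod.snd_swap] at hΓ hA
  set A : ℝ → ℝ := fun x => γ u₀ + G (x * (1 + u₀)) - F (u₀ * (1 + x)) with hAdef
  set Γ : ℝ → ℝ := fun u => α x₀ + F (u * (1 + x₀)) - G (x₀ * (1 + u)) with hΓdef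
  have hαA : ∀ᵐ x, 0 < x → α x = A x := by
    filter_upwards [hA] with x hx hx0
    simp only [hAdef]; linarith [hx hx0 hu₀]
  have hγΓ : ∀ᵐ u, 0 < u → γ u = Γ u := by
    filter_upwards [hΓ] with u hu hu0
    simp only [hΓdef]; linarith [hu hx₀ hu0]
  have hall : ∀ x u, 0 < x → 0 < u → A x + F (u * (1 + x)) = Γ u + G (x * (1 + u)) := by
    have hcomp : ∀ {f : ℝ → ℝ}, ContDiffOn ℝ 2 f (Ioi 0) → ∀ {g : ℝ × ℝ → ℝ}, Continuous g →
        (∀ z ∈ Ioi (0 : ℝ) ×ˢ Ioi (0 : ℝ), 0 < g z) →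
        ContinuousOn (fun z => f (g z)) (Ioi (0 : ℝ) ×ˢ Ioi (0 : ℝ)) :=
      fun hf g hg hpos => hf.continuousOn.comp hg.continuousOn fun z hz => hpos z hz
    have hpos : ∀ z ∈ Ioi (0 : ℝ) ×ˢ Ioi (0 : ℝ), 0 < z.1 ∧ 0 < z.2 := fun z hz => hz
    have key := Measure.eqOn_open_of_ae_eq (μ := (volume : Measure (ℝ × ℝ)))
      (U := Ioi (0 : ℝ) ×ˢ Ioi (0 : ℝ))
      (f := fun z => A z.1 + F (z.2 * (1 + z.1))) (g := fun z => Γ z.2 + G (z.1 * (1 + z.2)))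
      ?_ (isOpen_Ioi.prod isOpen_Ioi) ?_ ?_
    · exact fun x u hx hu => key (x := (x, u)) ⟨hx, hu⟩
    · rw [EventuallyEq, ae_restrict_iff' (measurableSet_Ioi.prod measurableSet_Ioi)]
      filter_upwards [hE', Measure.quasiMeasurePreserving_fst.ae hαA,
        Measure.quasiMeasurePreserving_snd.ae hγΓ] with z h0 h1 h2 hz
      rw [← h1 hz.1, ← h2 hz.2]
      exact h0 hz.1 hz.2
    · simp only [hAdef]
      refine ((continuousOn_const.add (hcomp hGc (by fun_prop) ?_)).sub
        (hcomp hFc (by fun_prop) ?_)).add (hcomp hFc (by fun_prop) ?_) <;>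
      · intro z hz
        have := (hpos z hz).1
        have := (hpos z hz).2
        positivity
    · simp only [hΓdef]
      refine ((continuousOn_const.add (hcomp hFc (by fun_prop) ?_)).sub
        (hcomp hGc (by fun_prop) ?_)).add (hcomp hGc (by fun_prop) ?_) <;>
      · intro z hz
        have := (hpos z hz).1
        have := (hpos z hz).2
        positivity
  obtain ⟨c, hcF, hcG⟩ := exists_const_deriv_mul_deriv hFc hGc hall
  have hd : ∀ {f : ℝ → ℝ}, ContDiffOn ℝ 2 f (Ioi 0) → ∀ y, 0 < y → HasDerivAt f (deriv f y) y :=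
    fun hf y hy => ((hf.differentiableOn (by norm_num)).differentiableAt
      (Ioi_mem_nhds hy)).hasDerivAt
  obtain ⟨b, k₂, hFe⟩ := eq_log_of_hasDerivAt_mul_deriv (hd hFc) hcF
  obtain ⟨a, k₄, hGe⟩ := eq_log_of_hasDerivAt_mul_deriv (hd hGc) hcG
  refine ⟨a, b, c, γ u₀ + a * Real.log (1 + u₀) + k₄ - b * Real.log u₀ + c * u₀ - k₂, k₂,
    α x₀ + b * Real.log (1 + x₀) + k₂ - a * Real.log x₀ + c * x₀ - k₄, k₄, ?_, ?_, ?_, ?_⟩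
  · filter_upwards [hαA] with x hx hx0
    rw [hx hx0]
    simp only [hAdef]
    rw [hGe _ (by positivity), hFe _ (by positivity), Real.log_mul hx0.ne' (by positivity),
      Real.log_mul hu₀.ne' (by positivity)]
    ring
  · filter_upwards [hF] with y hy hy0
    rw [hy hy0, hFe y hy0]
  · filter_upwards [hγΓ] with x hx hx0
    rw [hx hx0]
    simp only [hΓdef]
    rw [hGe _ (by positivity), hFe _ (by positivity), Real.log_mul hx0.ne' (by positivity),
      Real.log_mul hx₀.ne' (by positivity)]
    ring
  · filter_upwards [hG] with y hy hy0
    rw [hy hy0, hGe y hy0]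

lemma map_prod_div_withDensity {p q : ℝ → ENNReal} (hp : Measurable p) (hq : Measurable q)
    (hp0 : ∀ x ≤ 0, p x = 0) [SigmaFinite (volume.withDensity p)]
    [SigmaFinite (volume.withDensity q)] :
    Measure.map (fun z : ℝ × ℝ => (z.1, z.2 / (1 + z.1)))
      ((volume.withDensity p).prod (volume.withDensity q)) =
    (volume : Measure (ℝ × ℝ)).withDensity
      fun z => p z.1 * q (z.2 * (1 + z.1)) * ENNReal.ofReal (1 + z.1) := by
  refine Measure.ext_of_lintegral _ fun f hf => ?_
  rw [lintegral_map hf (by fun_prop), prod_withDensity hp hq,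
    lintegral_withDensity_eq_lintegral_mul _ (by fun_prop) (by fun_prop),
    lintegral_withDensity_eq_lintegral_mul _ (by fun_prop) hf, Measure.volume_eq_prod,
    lintegral_prod _ (by fun_prop), lintegral_prod _ (by fun_prop)]
  refine lintegral_congr fun x => ?_
  rcases le_or_gt x 0 with hx | hx
  · simp [hp0 x hx]
  have hx1 : 0 < 1 + x := by positivity
  have himg : (fun u : ℝ => u * (1 + x)) '' univ = univ := by
    rw [image_univ, range_eq_univ]
    exact fun y => ⟨y / (1 + x), div_mul_cancel₀ _ hx1.ne'⟩
  have := lintegral_image_eq_lintegral_abs_deriv_mul (s := univ) (f := fun u : ℝ => u * (1 + x))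
    (f' := fun _ => 1 + x) MeasurableSet.univ
    (fun u _ => (((hasDerivAt_id u).mul_const (1 + x)).congr_deriv (one_mul _)).hasDerivWithinAt)
    ((mul_left_injective₀ hx1.ne').injOn)
    (fun y => p x * q y * f (x, y / (1 + x)))
  rw [himg, Measure.restrict_univ] at this
  simp only [Pi.mul_apply]
  rw [this]
  refine lintegral_congr fun u => ?_
  rw [abs_of_pos hx1, mul_div_cancel_right₀ _ hx1.ne']
  ring

lemma exists_withDensity_of_pos {Ω : Type*} [MeasurableSpace Ω] {P : Measure Ω}
    [IsProbabilityMeasure P] {W : Ω → ℝ} (hW : Measurable W) (hpos : ∀ ω, 0 < W ω)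
    (hac : Measure.map W P ≪ volume) :
    ∃ g : ℝ → ENNReal, Measurable g ∧ (∀ x ≤ 0, g x = 0) ∧
      Measure.map W P = volume.withDensity g := by
  refine ⟨(Ioi 0).indicator ((Measure.map W P).rnDeriv volume),
    (Measure.measurable_rnDeriv _ _).indicator measurableSet_Ioi, fun x hx => by simp [hx], ?_⟩
  rw [withDensity_indicator measurableSet_Ioi, ← restrict_withDensity measurableSet_Ioi,
    Measure.withDensity_rnDeriv_eq _ _ hac, Measure.restrict_eq_self_of_ae_mem]
  exact (ae_map_iff hW.aemeasurable (p := (· ∈ Ioi 0)) measurableSet_Ioi).2 (ae_of_all _ hpos)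

lemma aemeasurable_indicator_of_log {f : ℝ → ℝ} (hf : ∀ x ∈ Ioi (0 : ℝ), 0 < f x)
    (hlog : LocallyIntegrableOn (fun x => Real.log (f x)) (Ioi 0)) :
    AEMeasurable ((Ioi (0 : ℝ)).indicator f) := by
  rw [aemeasurable_indicator_iff measurableSet_Ioi]
  refine (Real.measurable_exp.comp_aemeasurable hlog.aestronglyMeasurable.aemeasurable).congr ?_
  filter_upwards [ae_restrict_mem measurableSet_Ioi] with x hx
  exact Real.exp_log (hf x hx)

lemma withDensity_comp_swap (h : ℝ × ℝ → ENNReal) :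
    Measure.map Prod.swap ((volume : Measure (ℝ × ℝ)).withDensity h) =
      (volume : Measure (ℝ × ℝ)).withDensity (h ∘ Prod.swap) := by
  have hmp : MeasurePreserving (Prod.swap : ℝ × ℝ → ℝ × ℝ) volume volume :=
    Measure.measurePreserving_swap
  ext s hs
  rw [Measure.map_apply measurable_swap hs, withDensity_apply _ hs,
    withDensity_apply _ (measurable_swap hs)]
  rw [← hmp.setLIntegral_comp_preimage_emb MeasurableEquiv.prodComm.measurableEmbedding
    (h ∘ Prod.swap) s]
  simp

lemma integrableOn_of_withDensity {μ : Measure ℝ} [IsFiniteMeasure μ] {g : ℝ → ℝ}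
    (hμ : μ = volume.withDensity fun x => ENNReal.ofReal ((Ioi (0 : ℝ)).indicator g x))
    (hg : Measurable g) (hpos : ∀ x, 0 < x → 0 ≤ g x) : IntegrableOn g (Ioi 0) := by
  rw [← integrable_indicator_iff measurableSet_Ioi]
  refine ⟨(hg.indicator measurableSet_Ioi).aestronglyMeasurable, ?_⟩
  have hnn : ∀ x, 0 ≤ (Ioi (0 : ℝ)).indicator g x := indicator_nonneg fun x hx => hpos x hx
  rw [hasFiniteIntegral_iff_ofReal (ae_of_all _ hnn)]
  have := measure_lt_top μ univ
  rwa [hμ, withDensity_apply _ MeasurableSet.univ, Measure.restrict_univ] at this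

lemma pos_of_integrableOn_rpow_mul {a : ℝ} {g : ℝ → ℝ} (hg : ContinuousOn g (Icc 0 1))
    (hpos : ∀ x ∈ Icc (0 : ℝ) 1, 0 < g x)
    (h : IntegrableOn (fun x => x ^ (a - 1) * g x) (Ioi 0)) : 0 < a := by
  have h1 : IntegrableOn (fun x => x ^ (a - 1) * g x) (Icc 0 1) := by
    rw [integrableOn_Icc_iff_integrableOn_Ioo]
    exact h.mono_set Ioo_subset_Ioi_self
  have h2 := h1.mul_continuousOn (hg.inv₀ fun x hx => (hpos x hx).ne') isCompact_Icc
  have h3 : IntegrableOn (fun x : ℝ => x ^ (a - 1)) (Ioo 0 1) := by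
    refine (h2.mono_set Ioo_subset_Icc_self).congr_fun (fun x hx => ?_) measurableSet_Ioo
    exact mul_inv_cancel_right₀ (hpos x (Ioo_subset_Icc_self hx)).ne' _
  rw [intervalIntegral.integrableOn_Ioo_rpow_iff one_pos] at h3
  linarith

lemma IsKummer.pos_left {μ : Measure ℝ} [IsFiniteMeasure μ] {a b c : ℝ} (h : IsKummer μ a b c) :
    0 < a := by
  obtain ⟨C, hC, hμ⟩ := h
  have hi := integrableOn_of_withDensity hμ (by fun_prop) fun x hx => by positivity
  refine pos_of_integrableOn_rpow_mul
    (g := fun x => C * (1 + x) ^ (-(a + b)) * Real.exp (-(c * x))) ?_ ?_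
    (hi.congr_fun (fun x _ => by ring) measurableSet_Ioi)
  · refine (continuousOn_const.mul (ContinuousOn.rpow_const (by fun_prop) ?_)).mul (by fun_prop)
    exact fun x hx => Or.inl (by linarith [hx.1])
  · intro x hx
    have : 0 < 1 + x := by linarith [hx.1]
    positivity

lemma IsGamma.pos {μ : Measure ℝ} [IsFiniteMeasure μ] {b c : ℝ} (h : IsGamma μ b c) :
    0 < b ∧ 0 < c := by
  obtain ⟨C, hC, hμ⟩ := h
  have hi := integrableOn_of_withDensity hμ (by fun_prop) fun x hx => by positivity
  have hb : 0 < b := pos_of_integrableOn_rpow_mul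
    (g := fun x => C * Real.exp (-(c * x))) (by fun_prop) (fun x _ => by positivity)
    (hi.congr_fun (fun x _ => by ring) measurableSet_Ioi)
  refine ⟨hb, ?_⟩
  by_contra! hc
  have h1 : IntegrableOn (fun x : ℝ => x ^ (-1 : ℝ)) (Ioi 1) := by
    refine Integrable.mono' ((hi.mono_set (Ioi_subset_Ioi zero_le_one)).const_mul C⁻¹)
      (by fun_prop) ?_
    filter_upwards [ae_restrict_mem measurableSet_Ioi] with x hx
    have hx1 : (1 : ℝ) < x := hx
    have hx0 : 0 < x := by linarith
    rw [Real.norm_of_nonneg (by positivity)]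
    have e1 : x ^ (-1 : ℝ) ≤ x ^ (b - 1) := Real.rpow_le_rpow_of_exponent_le hx1.le (by linarith)
    have e2 : 1 ≤ Real.exp (-(c * x)) := Real.one_le_exp (by nlinarith)
    calc x ^ (-1 : ℝ) ≤ x ^ (b - 1) * Real.exp (-(c * x)) := by
          nlinarith [Real.rpow_pos_of_pos hx0 (b - 1)]
      _ = C⁻¹ * (C * x ^ (b - 1) * Real.exp (-(c * x))) := by field_simp
  rw [integrableOn_Ioi_rpow_iff one_pos] at h1
  exact lt_irrefl _ h1

lemma withDensity_eq_of_ae_eq_on_pos {μ : Measure ℝ} {g : ℝ → ENNReal} {f : ℝ → ℝ}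
    (hμ : μ = volume.withDensity g) (hg0 : ∀ x ≤ 0, g x = 0)
    (h : ∀ᵐ x, 0 < x → g x = ENNReal.ofReal (f x)) :
    μ = volume.withDensity fun x => ENNReal.ofReal ((Ioi (0 : ℝ)).indicator f x) := by
  rw [hμ]
  refine withDensity_congr_ae ?_
  filter_upwards [h] with x hx
  rcases le_or_gt x 0 with h0 | h0
  · simp [hg0 x h0, h0]
  · simp [hx h0, h0]

lemma isGamma_of_log {μ : Measure ℝ} {g : ℝ → ENNReal} {r : ℝ → ℝ} {b c k : ℝ}
    (hμ : μ = volume.withDensity g) (hg0 : ∀ x ≤ 0, g x = 0)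
    (hr : ∀ᵐ x, 0 < x → 0 < r x ∧ g x = ENNReal.ofReal (r x))
    (hlog : ∀ᵐ x, 0 < x → Real.log (r x) = b * Real.log x - c * x + k) :
    IsGamma μ (b + 1) c := by
  refine ⟨Real.exp k, Real.exp_pos k, withDensity_eq_of_ae_eq_on_pos hμ hg0 ?_⟩
  filter_upwards [hr, hlog] with x hx1 hx2 hx0
  rw [(hx1 hx0).2, ← Real.exp_log (hx1 hx0).1, hx2 hx0, Real.rpow_def_of_pos hx0, ← Real.exp_add,
    ← Real.exp_add]
  ring_nf

lemma isKummer_of_log {μ : Measure ℝ} {g : ℝ → ENNReal} {r : ℝ → ℝ} {a b c k : ℝ}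
    (hμ : μ = volume.withDensity g) (hg0 : ∀ x ≤ 0, g x = 0)
    (hr : ∀ᵐ x, 0 < x → 0 < r x ∧ g x = ENNReal.ofReal (r x))
    (hlog : ∀ᵐ x, 0 < x → Real.log (r x) + Real.log (1 + x) =
      a * Real.log x - b * Real.log (1 + x) - c * x + k) :
    IsKummer μ (a + 1) (b - a) c := by
  refine ⟨Real.exp k, Real.exp_pos k, withDensity_eq_of_ae_eq_on_pos hμ hg0 ?_⟩
  filter_upwards [hr, hlog] with x hx1 hx2 hx0
  rw [(hx1 hx0).2, ← Real.exp_log (hx1 hx0).1, eq_sub_of_add_eq (hx2 hx0),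
    Real.rpow_def_of_pos hx0, Real.rpow_def_of_pos (by positivity : 0 < 1 + x), ← Real.exp_add,
    ← Real.exp_add, ← Real.exp_add]
  ring_nf

lemma log_mul_mul_of_ofReal_eq {p q s t : ℝ} {G H : ENNReal} (hp : 0 < p) (hq : 0 < q)
    (hs : 0 < s) (ht : 0 < t)
    (h : ENNReal.ofReal p * ENNReal.ofReal q * ENNReal.ofReal s = G * H * ENNReal.ofReal t) :
    0 < G.toReal ∧ 0 < H.toReal ∧ Real.log p + Real.log s + Real.log q =
      Real.log G.toReal + Real.log t + Real.log H.toReal := by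
  have h1 := congrArg ENNReal.toReal h
  simp only [ENNReal.toReal_mul, ENNReal.toReal_ofReal hp.le, ENNReal.toReal_ofReal hq.le,
    ENNReal.toReal_ofReal hs.le, ENNReal.toReal_ofReal ht.le] at h1
  have h2 : 0 < G.toReal * H.toReal * t := by rw [← h1]; positivity
  have hGH : G.toReal * H.toReal ≠ 0 := left_ne_zero_of_mul h2.ne'
  have hG : 0 < G.toReal := lt_of_le_of_ne ENNReal.toReal_nonneg (left_ne_zero_of_mul hGH).symm
  have hH : 0 < H.toReal := lt_of_le_of_ne ENNReal.toReal_nonneg (right_ne_zero_of_mul hGH).symm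
  refine ⟨hG, hH, ?_⟩
  have h3 := congrArg Real.log h1
  rw [Real.log_mul (by positivity) (by positivity), Real.log_mul (by positivity) (by positivity),
    Real.log_mul (by positivity) (by positivity), Real.log_mul (by positivity) (by positivity)]
    at h3
  linarith

/-- **Characterization of the Kummer and Gamma distributions by the HV independence
property.** If `X`, `Y` are independent positive random variables with strictly positive
densities on `(0,∞)` whose logarithms are locally integrable, and if
`U = Y/(1+X)` and `V = X(1 + Y/(1+X))` are independent, then there are `a, b, c > 0` such
that `X ~ K(a, b-a, c)`, `Y ~ G(b, c)`, or equivalently `U ~ K(b, a-b, c)`, `V ~ G(a, c)`. -/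
theorem kummer_gamma_hv_characterization
    {Ω : Type*} [MeasurableSpace Ω] {Pr : Measure Ω} [IsProbabilityMeasure Pr]
    (X Y : Ω → ℝ) (hX : Measurable X) (hY : Measurable Y)
    (hXpos : ∀ ω, 0 < X ω) (hYpos : ∀ ω, 0 < Y ω)
    (hindep : IndepFun X Y Pr)
    (fX fY : ℝ → ℝ)
    (hfXpos : ∀ x ∈ Ioi (0 : ℝ), 0 < fX x) (hfYpos : ∀ x ∈ Ioi (0 : ℝ), 0 < fY x)
    (hfXlog : LocallyIntegrableOn (fun x => Real.log (fX x)) (Ioi 0) volume)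
    (hfYlog : LocallyIntegrableOn (fun x => Real.log (fY x)) (Ioi 0) volume)
    (hlawX : Measure.map X Pr = volume.withDensity fun x =>
      ENNReal.ofReal ((Ioi (0 : ℝ)).indicator fX x))
    (hlawY : Measure.map Y Pr = volume.withDensity fun x =>
      ENNReal.ofReal ((Ioi (0 : ℝ)).indicator fY x))
    (U V : Ω → ℝ)
    (hU : U = fun ω => Y ω / (1 + X ω))
    (hV : V = fun ω => X ω * (1 + Y ω / (1 + X ω)))
    (hindepUV : IndepFun U V Pr) :
    ∃ a b c : ℝ, 0 < a ∧ 0 < b ∧ 0 < c ∧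
      IsKummer (Measure.map X Pr) a (b - a) c ∧ IsGamma (Measure.map Y Pr) b c ∧
      IsKummer (Measure.map U Pr) b (a - b) c ∧ IsGamma (Measure.map V Pr) a c := by
  have hacX : Measure.map X Pr ≪ volume := hlawX ▸ withDensity_absolutelyContinuous _ _
  have hacY : Measure.map Y Pr ≪ volume := hlawY ▸ withDensity_absolutelyContinuous _ _
  have hprob : ∀ {W : Ω → ℝ}, Measurable W → IsProbabilityMeasure (Measure.map W Pr) :=
    fun hW => Measure.isProbabilityMeasure_map hW.aemeasurable
  have hUm : Measurable U := by rw [hU]; fun_prop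
  have hVm : Measurable V := by rw [hV]; fun_prop
  have hUpos : ∀ ω, 0 < U ω := fun ω => by
    have := hXpos ω
    have := hYpos ω
    rw [hU]; positivity
  have hVU : ∀ ω, V ω = X ω * (1 + U ω) := fun ω => by rw [hV, hU]
  have hVpos : ∀ ω, 0 < V ω := fun ω => by
    have := hXpos ω
    have := hUpos ω
    rw [hVU]; positivity
  have hjoint : ∀ {W Z : Ω → ℝ} {p q : ℝ → ENNReal}, Measurable W → Measurable Z →
      IndepFun W Z Pr → Measurable p → Measurable q → (∀ x ≤ 0, p x = 0) →
      Measure.map W Pr = volume.withDensity p → Measure.map Z Pr = volume.withDensity q →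
      Measure.map (fun ω => (W ω, Z ω / (1 + W ω))) Pr = (volume : Measure (ℝ × ℝ)).withDensity
        fun z => p z.1 * q (z.2 * (1 + z.1)) * ENNReal.ofReal (1 + z.1) := by
    intro W Z p q hW hZ hi hp hq hp0 hWp hZq
    have := hprob hW
    have := hprob hZ
    have h1 : SigmaFinite (volume.withDensity p) := hWp ▸ inferInstance
    have h2 : SigmaFinite (volume.withDensity q) := hZq ▸ inferInstance
    rw [← map_prod_div_withDensity hp hq hp0, ← hWp, ← hZq,
      ← (indepFun_iff_map_prod_eq_prod_map_map hW.aemeasurable hZ.aemeasurable).1 hi,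
      Measure.map_map (by fun_prop) (by fun_prop)]
    rfl
  obtain ⟨gX, hgXm, hgX0, hgX⟩ := exists_withDensity_of_pos hX hXpos hacX
  obtain ⟨gY, hgYm, hgY0, hgY⟩ := exists_withDensity_of_pos hY hYpos hacY
  have hXU := hjoint hX hY hindep hgXm hgYm hgX0 hgX hgY
  have hUeq : (fun ω => (X ω, Y ω / (1 + X ω))) = fun ω => (X ω, U ω) := by rw [hU]
  rw [hUeq] at hXU
  have hacXU : Measure.map (fun ω => (X ω, U ω)) Pr ≪ (volume : Measure (ℝ × ℝ)) :=
    hXU ▸ withDensity_absolutelyContinuous _ _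
  have hae : ∀ {p : ℝ × ℝ → Prop}, (∀ᵐ z, p z) → ∀ᵐ ω ∂Pr, p (X ω, U ω) := fun hp =>
    ae_of_ae_map (hX.prodMk hUm).aemeasurable (hacXU.ae_le hp)
  have hac : ∀ {W : Ω → ℝ}, Measurable W →
      (∀ N, volume N = 0 → ∀ᵐ ω ∂Pr, W ω ∉ N) → Measure.map W Pr ≪ volume := by
    intro W hW h
    refine Measure.AbsolutelyContinuous.mk fun N hNm hN => ?_
    rw [Measure.map_apply hW hNm]
    exact measure_eq_zero_iff_ae_notMem.2 (h N hN)
  have hacU : Measure.map U Pr ≪ volume := hac hUm fun N hN =>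
    hae (Measure.quasiMeasurePreserving_snd.ae (measure_eq_zero_iff_ae_notMem.1 hN))
  have hacV : Measure.map V Pr ≪ volume := hac hVm fun N hN => by
    filter_upwards [hae (ae_swap (ae_prod_comp_mul (measure_eq_zero_iff_ae_notMem.1 hN)))]
      with ω hω
    rw [hVU]
    exact hω (hUpos ω)
  obtain ⟨gU, hgUm, hgU0, hgU⟩ := exists_withDensity_of_pos hUm hUpos hacU
  obtain ⟨gV, hgVm, hgV0, hgV⟩ := exists_withDensity_of_pos hVm hVpos hacV
  have hUX := hjoint hUm hVm hindepUV hgUm hgVm hgU0 hgU hgV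
  have hXeq : (fun ω => (U ω, V ω / (1 + U ω))) = Prod.swap ∘ fun ω => (X ω, U ω) := by
    funext ω
    have := hUpos ω
    simp only [Function.comp, Prod.swap_prod_mk, hVU]
    rw [mul_div_cancel_right₀ _ (by positivity)]
  rw [hXeq, ← Measure.map_map measurable_swap (by fun_prop), hXU, withDensity_comp_swap] at hUX
  have hdens := (withDensity_eq_iff (by fun_prop) (by fun_prop) ?_).1 hUX
  swap
  · rw [← setLIntegral_univ, ← withDensity_apply _ MeasurableSet.univ, ← withDensity_comp_swap,
      ← hXU]
    have := Measure.isProbabilityMeasure_map (μ := Pr) (hX.prodMk hUm).aemeasurable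
    have := Measure.isProbabilityMeasure_map
      (μ := Measure.map (fun ω => (X ω, U ω)) Pr) measurable_swap.aemeasurable
    exact measure_ne_top _ _
  have hversion : ∀ {W : Ω → ℝ} {g : ℝ → ENNReal} {f : ℝ → ℝ}, Measurable W → Measurable g →
      (∀ x ∈ Ioi (0 : ℝ), 0 < f x) →
      LocallyIntegrableOn (fun x => Real.log (f x)) (Ioi 0) volume →
      Measure.map W Pr = volume.withDensity g →
      Measure.map W Pr = volume.withDensity (fun x =>
        ENNReal.ofReal ((Ioi (0 : ℝ)).indicator f x)) →
      ∀ᵐ x, 0 < x → g x = ENNReal.ofReal (f x) := by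
    intro W g f hW hg hf hlog h1 h2
    have := hprob hW
    have h3 := (withDensity_eq_iff hg.aemeasurable
      (aemeasurable_indicator_of_log hf hlog).ennreal_ofReal ?_).1 (h1.symm.trans h2)
    · filter_upwards [h3] with x hx hx0
      simpa [hx0] using hx
    · rw [← setLIntegral_univ, ← withDensity_apply _ MeasurableSet.univ, ← h1]
      exact measure_ne_top _ _
  have hvX := hversion hX hgXm hfXpos hfXlog hgX hlawX
  have hvY := hversion hY hgYm hfYpos hfYlog hgY hlawY
  have hkey : ∀ᵐ z : ℝ × ℝ, 0 < z.1 → 0 < z.2 →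
      0 < (gU z.2).toReal ∧ 0 < (gV (z.1 * (1 + z.2))).toReal ∧
      Real.log (fX z.1) + Real.log (1 + z.1) + Real.log (fY (z.2 * (1 + z.1))) =
        Real.log (gU z.2).toReal + Real.log (1 + z.2) +
          Real.log (gV (z.1 * (1 + z.2))).toReal := by
    filter_upwards [ae_swap hdens, Measure.quasiMeasurePreserving_fst.ae hvX,
      ae_prod_comp_mul hvY] with z h1 h2 h3 hx hu
    have hy : 0 < z.2 * (1 + z.1) := by positivity
    simp only [Function.comp, Prod.swap_swap, Prod.fst_swap, Prod.snd_swap] at h1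
    rw [h2 hx, h3 hx hy] at h1
    exact log_mul_mul_of_ofReal_eq (hfXpos _ hx) (hfYpos _ hy) (by positivity) (by positivity) h1
  have hlog1 : LocallyIntegrableOn (fun x : ℝ => Real.log (1 + x)) (Ioi 0) :=
    ContinuousOn.locallyIntegrableOn (ContinuousOn.log (by fun_prop) fun x hx => by
      have : (0 : ℝ) < x := hx
      positivity) measurableSet_Ioi
  obtain ⟨a, b, c, k₁, k₂, k₃, k₄, hα, hβ, hγ, hδ⟩ := kummer_gamma_functional_equation
    (α := fun x => Real.log (fX x) + Real.log (1 + x)) (β := fun y => Real.log (fY y))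
    (γ := fun u => Real.log (gU u).toReal + Real.log (1 + u))
    (δ := fun v => Real.log (gV v).toReal) (hfXlog.add hlog1) hfYlog
    (hkey.mono fun z hz hx hu => (hz hx hu).2.2)
  have hofReal : ∀ {t : ENNReal}, 0 < t.toReal → 0 < t.toReal ∧ t = ENNReal.ofReal t.toReal :=
    fun ht => ⟨ht, (ENNReal.ofReal_toReal (ENNReal.toReal_pos_iff.1 ht).2.ne).symm⟩
  have hrU : ∀ᵐ u, 0 < u → 0 < (gU u).toReal ∧ gU u = ENNReal.ofReal (gU u).toReal := by
    obtain ⟨x, hx, hs⟩ := exists_pos_of_ae (Measure.ae_ae_of_ae_prod hkey)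
    filter_upwards [hs] with u hu hu0 using hofReal (hu hx hu0).1
  have hrV : ∀ᵐ v, 0 < v → 0 < (gV v).toReal ∧ gV v = ENNReal.ofReal (gV v).toReal := by
    obtain ⟨u, hu, hs⟩ := exists_pos_of_ae (Measure.ae_ae_of_ae_prod (ae_swap hkey))
    have hu1 : 0 < 1 + u := by positivity
    filter_upwards [ae_comp_mul_right hs (inv_pos.2 hu1).ne'] with v hv hv0
    have := (hv (by simp only [Prod.fst_swap]; positivity) hu).2.1
    simp only [Prod.fst_swap, Prod.snd_swap, inv_mul_cancel_right₀ hu1.ne'] at this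
    exact hofReal this
  have hKX : IsKummer (Measure.map X Pr) (a + 1) (b - a) c := isKummer_of_log hgX hgX0
    (hvX.mono fun x hx hx0 => ⟨hfXpos x hx0, hx hx0⟩) hα
  have hGY : IsGamma (Measure.map Y Pr) (b + 1) c := isGamma_of_log hgY hgY0
    (hvY.mono fun x hx hx0 => ⟨hfYpos x hx0, hx hx0⟩) hβ
  have := hprob hX
  have := hprob hY
  refine ⟨a + 1, b + 1, c, hKX.pos_left, hGY.pos.1, hGY.pos.2, ?_, hGY, ?_,
    isGamma_of_log hgV hgV0 hrV hδ⟩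
  · rwa [add_sub_add_right_eq_sub]
  · rw [add_sub_add_right_eq_sub]
    exact isKummer_of_log hgU hgU0 hrU hγ
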